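/- arXiv:2204.08902 — 6 statements merged into one kernel-verified Lean document; each statement's English description precedes it below -/
import Mathlib

section
/- Let n ≥ 1 and k₀ ≥ 1 be natural numbers, let V > 0 be a real number, and let p be a natural number with p ≥ k₀. Suppose Λ : ℕ → ℝ satisfies Λ(m) ≥ (4π² / (ω_n · V)^{2/n}) · m^{2/n} for every natural number m ≥ k₀, and F : ℕ → ℝ satisfies F(k) ≥ Λ(k·p) for every k ≥ 1. Then for every k ≥ 1 one has F(k) ≥ (4π² / (ω_n · (V/p))^{2/n}) · k^{2/n}. -/
/-- The volume of the unit ball in `ℝ^m`. -/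
noncomputable def unitBallVol (m : ℕ) : ℝ :=
  Real.pi ^ ((m : ℝ) / 2) / Real.Gamma ((m : ℝ) / 2 + 1)

theorem unitBallVol_pos (m : ℕ) : 0 < unitBallVol m :=
  div_pos (Real.rpow_pos_of_pos Real.pi_pos _) (Real.Gamma_pos_of_pos (by positivity))

/-- Dirichlet part of the basic lemma: if `Λ` (the eigenvalues of `Ω`, of volume `V`)
satisfies Pólya's inequality from order `k₀` on, and `F` (the eigenvalues of a subdomain
`Ω_p` that `p`-tiles `Ω`) satisfies `F k ≥ Λ (k * p)`, then for `p ≥ k₀` the sequence `F`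
satisfies Pólya's inequality (with volume `V / p`) at all orders. -/
theorem polya_dirichlet_of_tiling (n k₀ : ℕ) (hn : 1 ≤ n) (hk₀ : 1 ≤ k₀)
    (V : ℝ) (hV : 0 < V) (p : ℕ) (hp : k₀ ≤ p) (Λ F : ℕ → ℝ)
    (hΛ : ∀ m : ℕ, k₀ ≤ m →
      4 * Real.pi ^ 2 / (unitBallVol n * V) ^ ((2 : ℝ) / n) * (m : ℝ) ^ ((2 : ℝ) / n) ≤ Λ m)
    (hF : ∀ k : ℕ, 1 ≤ k → Λ (k * p) ≤ F k) :
    ∀ k : ℕ, 1 ≤ k →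
      4 * Real.pi ^ 2 / (unitBallVol n * (V / p)) ^ ((2 : ℝ) / n) * (k : ℝ) ^ ((2 : ℝ) / n)
        ≤ F k := by
  intro k hk
  have hp0 : (0 : ℝ) < p := by exact_mod_cast hk₀.trans hp
  have hω : 0 < unitBallVol n * V := mul_pos (unitBallVol_pos n) hV
  refine le_trans (le_of_eq ?_) ((hΛ (k * p) (hp.trans (Nat.le_mul_of_pos_left p hk))).trans
    (hF k hk))
  rw [← mul_div_assoc, Real.div_rpow hω.le hp0.le, Nat.cast_mul,
    Real.mul_rpow k.cast_nonneg hp0.le]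
  have := Real.rpow_pos_of_pos hω ((2 : ℝ) / n)
  have := Real.rpow_pos_of_pos hp0 ((2 : ℝ) / n)
  field_simp
end

section
/- Let n ≥ 1 and k₀ ≥ 1 be natural numbers, let V > 0 be a real number, and let p be a natural number with p ≥ k₀. Suppose M : ℕ → ℝ satisfies M(m) ≤ (4π² / (ω_n · V)^{2/n}) · (m−1)^{2/n} for every natural number m ≥ k₀, and μ : ℕ → ℝ satisfies μ(1) = 0 and μ(k) ≤ M((k−1)·p + 1) for every k ≥ 1. Then for every k ≥ 1 one has μ(k) ≤ (4π² / (ω_n · (V/p))^{2/n}) · (k−1)^{2/n}. -/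
/-- Neumann part of the basic lemma: if `M` (the Neumann eigenvalues of `Ω`, of volume `V`)
satisfies Pólya's inequality from order `k₀` on, and `μ` (the Neumann eigenvalues of a subdomain
`Ω_p` that `p`-tiles `Ω`) satisfies `μ 1 = 0` and `μ k ≤ M ((k-1) * p + 1)`, then for `p ≥ k₀`
the sequence `μ` satisfies Pólya's inequality (with volume `V / p`) at all orders. -/
theorem polya_neumann_of_tiling (n k₀ : ℕ) (hn : 1 ≤ n) (hk₀ : 1 ≤ k₀)
    (V : ℝ) (hV : 0 < V) (p : ℕ) (hp : k₀ ≤ p) (M μ : ℕ → ℝ)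
    (hM : ∀ m : ℕ, k₀ ≤ m →
      M m ≤ 4 * Real.pi ^ 2 / (unitBallVol n * V) ^ ((2 : ℝ) / n) * ((m : ℝ) - 1) ^ ((2 : ℝ) / n))
    (hμ1 : μ 1 = 0)
    (hμ : ∀ k : ℕ, 1 ≤ k → μ k ≤ M ((k - 1) * p + 1)) :
    ∀ k : ℕ, 1 ≤ k →
      μ k ≤ 4 * Real.pi ^ 2 / (unitBallVol n * (V / p)) ^ ((2 : ℝ) / n)
        * ((k : ℝ) - 1) ^ ((2 : ℝ) / n) := by
  intro k hk
  obtain ⟨j, rfl⟩ := Nat.exists_eq_add_of_le' hk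
  rcases Nat.eq_zero_or_pos j with rfl | hj
  · have ha : (2 : ℝ) / n ≠ 0 := by positivity
    simp [hμ1, Real.zero_rpow ha]
  · have hp0 : (0 : ℝ) < p := by exact_mod_cast hk₀.trans hp
    have hW : 0 < unitBallVol n := unitBallVol_pos n
    have hm : k₀ ≤ j * p + 1 := by nlinarith
    refine ((hμ (j + 1) hk).trans (hM _ (by simpa using hm))).trans_eq ?_
    have h₁ : (((j + 1 - 1) * p + 1 : ℕ) : ℝ) - 1 = j * p := by
      simp
    have h₂ : ((j + 1 : ℕ) : ℝ) - 1 = j := by simp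
    rw [h₁, h₂, ← mul_div_assoc, Real.mul_rpow (Nat.cast_nonneg j) hp0.le,
      Real.div_rpow (by positivity) hp0.le]
    field_simp
end

section
/- Let n ≥ 1 be a natural number, A > 0 and ℓ > 0 real numbers, and let η : ℕ → ℝ (with indices j ≥ 1) be a nondecreasing sequence satisfying the Berezin–Li–Yau inequality with parameters n and A. Then for every real number λ and every natural number m ≥ 1 with η(m) ≤ λ, one has ∑_{j=1}^{m} (ℓ/π)·√(λ − η(j)) ≤ (ℓ·m/π) · √(λ − (n/(n+2)) · 4π² · m^{2/n} / (ω_n · A)^{2/n}). -/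
/-- `η` satisfies the Berezin–Li–Yau inequality with parameters `n` and `A`. -/
def BerezinLiYau (n : ℕ) (A : ℝ) (η : ℕ → ℝ) : Prop :=
  ∀ k : ℕ, 1 ≤ k →
    (n / (n + 2) : ℝ) * (4 * Real.pi ^ 2) * (k : ℝ) ^ (1 + 2 / (n : ℝ))
        / (unitBallVol n * A) ^ ((2 : ℝ) / n)
      ≤ ∑ j ∈ Finset.Icc 1 k, η j

/-- Cauchy–Schwarz for a sum of square roots: if the sum of nonnegative reals is at most `#s * b`,
then the sum of their square roots is at most `#s * √b`. -/
theorem sum_sqrt_le_card_mul_sqrt {ι : Type*} (s : Finset ι) (x : ι → ℝ) (b : ℝ)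
    (hx : ∀ i ∈ s, 0 ≤ x i) (hb : ∑ i ∈ s, x i ≤ s.card * b) :
    ∑ i ∈ s, Real.sqrt (x i) ≤ s.card * Real.sqrt b := by
  have hsq : (∑ i ∈ s, Real.sqrt (x i)) ^ 2 ≤ (s.card : ℝ) ^ 2 * b := by
    calc (∑ i ∈ s, Real.sqrt (x i)) ^ 2
        ≤ s.card * ∑ i ∈ s, Real.sqrt (x i) ^ 2 := sq_sum_le_card_mul_sum_sq
      _ = s.card * ∑ i ∈ s, x i := by
        rw [Finset.sum_congr rfl fun i hi => Real.sq_sqrt (hx i hi)]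
      _ ≤ s.card * (s.card * b) := by gcongr
      _ = (s.card : ℝ) ^ 2 * b := by ring
  calc ∑ i ∈ s, Real.sqrt (x i) ≤ Real.sqrt ((s.card : ℝ) ^ 2 * b) := Real.le_sqrt_of_sq_le hsq
    _ = s.card * Real.sqrt b := by
      rw [Real.sqrt_mul (by positivity), Real.sqrt_sq (by positivity)]

/-- Cauchy–Schwarz step combined with the Berezin–Li–Yau bound in the proof of the
cylinder theorem. -/
theorem cauchySchwarz_BLY_step (n : ℕ) (hn : 1 ≤ n) (A ℓ : ℝ) (hA : 0 < A) (hℓ : 0 < ℓ)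
    (η : ℕ → ℝ) (hmono : Monotone η) (hBLY : BerezinLiYau n A η) :
    ∀ (lam : ℝ) (m : ℕ), 1 ≤ m → η m ≤ lam →
      ∑ j ∈ Finset.Icc 1 m, (ℓ / Real.pi) * Real.sqrt (lam - η j)
        ≤ (ℓ * m / Real.pi) *
          Real.sqrt (lam - (n / (n + 2) : ℝ) * (4 * Real.pi ^ 2) * (m : ℝ) ^ ((2 : ℝ) / n)
            / (unitBallVol n * A) ^ ((2 : ℝ) / n)) := by
  intro lam m hm hlam
  have hm_pos : (0 : ℝ) < m := by exact_mod_cast hm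
  have hsum := hBLY m hm
  rw [Real.rpow_add hm_pos, Real.rpow_one] at hsum
  have key := sum_sqrt_le_card_mul_sqrt (Finset.Icc 1 m) (fun j => lam - η j)
    (lam - (n / (n + 2) : ℝ) * (4 * Real.pi ^ 2) * (m : ℝ) ^ ((2 : ℝ) / n)
      / (unitBallVol n * A) ^ ((2 : ℝ) / n))
    (fun j hj => sub_nonneg.2 ((hmono (Finset.mem_Icc.1 hj).2).trans hlam))
    (by
      rw [Finset.sum_sub_distrib, Finset.sum_const, Nat.card_Icc, Nat.add_sub_cancel,
        nsmul_eq_mul, mul_sub]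
      refine sub_le_sub_left (le_of_eq_of_le ?_ hsum) _
      ring)
  rw [Nat.card_Icc, Nat.add_sub_cancel] at key
  rw [← Finset.mul_sum, mul_div_right_comm, mul_assoc]
  exact mul_le_mul_of_nonneg_left key (by positivity)
end

section
/- Let n ≥ 1 be a natural number, A > 0 and ℓ > 0 real numbers, and let η : ℕ → ℝ (with indices j ≥ 1) be a nondecreasing sequence satisfying the Berezin–Li–Yau inequality with parameters n and A. Let λ > 0, set m := the number of indices j ≥ 1 with η(j) ≤ λ, and k := the number of pairs of positive integers (j, l) with η(j) + π²·l²/ℓ² ≤ λ. If k ≥ 1, then m ≥ 1 and λ ≥ π²·k²/(ℓ²·m²) + (n/(n+2)) · 4π² · m^{2/n} / (ω_n · A)^{2/n}. -/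
/-- The Berezin–Li–Yau inequality as a lower bound for the mean of the first `k` terms. -/
theorem BerezinLiYau.mul_le_sum {n : ℕ} {A : ℝ} {η : ℕ → ℝ} (h : BerezinLiYau n A η)
    {k : ℕ} (hk : 1 ≤ k) :
    (k : ℝ) * ((n / (n + 2) : ℝ) * (4 * Real.pi ^ 2) * (k : ℝ) ^ ((2 : ℝ) / n)
        / (unitBallVol n * A) ^ ((2 : ℝ) / n)) ≤ ∑ j ∈ Finset.Icc 1 k, η j := by
  have hk0 : (0 : ℝ) < k := by exact_mod_cast hk
  have h1 := h k hk
  rw [Real.rpow_add hk0, Real.rpow_one] at h1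
  convert h1 using 1
  ring

/-- A sequence satisfying the Berezin–Li–Yau inequality is unbounded above. -/
theorem BerezinLiYau.exists_lt {n : ℕ} (hn : 1 ≤ n) {A : ℝ} (hA : 0 < A) {η : ℕ → ℝ}
    (h : BerezinLiYau n A η) (c : ℝ) : ∃ N, c < η N := by
  by_contra! hc
  have hn0 : (0 : ℝ) < n := by exact_mod_cast hn
  have hω := unitBallVol_pos n
  have hπ := Real.pi_pos
  have hC : 0 < (n / (n + 2) : ℝ) * (4 * Real.pi ^ 2) / (unitBallVol n * A) ^ ((2 : ℝ) / n) := by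
    positivity
  have ht : Filter.Tendsto (fun k : ℕ => (n / (n + 2) : ℝ) * (4 * Real.pi ^ 2)
      / (unitBallVol n * A) ^ ((2 : ℝ) / n) * (k : ℝ) ^ ((2 : ℝ) / n))
      Filter.atTop Filter.atTop :=
    (((tendsto_rpow_atTop (by positivity : (0 : ℝ) < 2 / n)).comp
      tendsto_natCast_atTop_atTop).const_mul_atTop hC)
  obtain ⟨k, hk, hk1⟩ := ((ht.eventually_gt_atTop c).and (Filter.eventually_ge_atTop 1)).exists
  have hk0 : (0 : ℝ) < k := by exact_mod_cast hk1
  have hs : ∑ j ∈ Finset.Icc 1 k, η j ≤ k * c := by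
    simpa using Finset.sum_le_card_nsmul (Finset.Icc 1 k) η c fun j _ => hc j
  have hle := le_of_mul_le_mul_left ((h.mul_le_sum hk1).trans hs) hk0
  rw [mul_div_right_comm] at hle
  exact absurd hk hle.not_gt

/-- The sublevel set of a monotone sequence is an initial segment. -/
theorem Monotone.sublevel_eq_Icc {η : ℕ → ℝ} (hη : Monotone η) {c : ℝ} (h : ∃ N, c < η N) :
    {j : ℕ | 1 ≤ j ∧ η j ≤ c} =
      Finset.Icc 1 (Nat.card {j : ℕ | 1 ≤ j ∧ η j ≤ c}) := by
  classical
  have key : {j : ℕ | 1 ≤ j ∧ η j ≤ c} = Finset.Icc 1 (Nat.find h - 1) := by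
    ext j
    simp only [Set.mem_ofPred_eq, Finset.coe_Icc, Set.mem_Icc]
    refine and_congr_right fun hj => ⟨fun hle => ?_, fun hlt => ?_⟩
    · have : j < Nat.find h := hη.reflect_lt (hle.trans_lt (Nat.find_spec h))
      omega
    · exact not_lt.mp (Nat.find_min h (by omega))
  have hcard : Nat.card {j : ℕ | 1 ≤ j ∧ η j ≤ c} = Nat.find h - 1 := by
    rw [key]
    simp
  rw [hcard, key]

/-- The number of cylinder eigenvalues up to `lam` is at most the sum over the base eigenvalues
`η j ≤ lam` of `(ℓ / π) √(lam - η j)`. -/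
theorem card_pairs_le {η : ℕ → ℝ} {lam ℓ : ℝ} (hℓ : 0 < ℓ) {s : Finset ℕ}
    (hs : {j : ℕ | 1 ≤ j ∧ η j ≤ lam} = s) :
    (Nat.card {q : ℕ × ℕ | 1 ≤ q.1 ∧ 1 ≤ q.2 ∧
        η q.1 + Real.pi ^ 2 * (q.2 : ℝ) ^ 2 / ℓ ^ 2 ≤ lam} : ℝ)
      ≤ ∑ j ∈ s, ℓ / Real.pi * √(lam - η j) := by
  have hπ := Real.pi_pos
  set t : Finset (ℕ × ℕ) :=
    s.biUnion fun j => {j} ×ˢ Finset.Icc 1 ⌊ℓ / Real.pi * √(lam - η j)⌋₊ with ht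
  have hsub : {q : ℕ × ℕ | 1 ≤ q.1 ∧ 1 ≤ q.2 ∧
      η q.1 + Real.pi ^ 2 * (q.2 : ℝ) ^ 2 / ℓ ^ 2 ≤ lam} ⊆ t := by
    rintro ⟨j, l⟩ ⟨hj, hl, hq⟩
    dsimp only at hj hl hq
    have hjs : j ∈ s := by
      have : j ∈ {j : ℕ | 1 ≤ j ∧ η j ≤ lam} :=
        ⟨hj, by linarith [show 0 ≤ Real.pi ^ 2 * (l : ℝ) ^ 2 / ℓ ^ 2 by positivity]⟩
      rwa [hs] at this
    have hroot : Real.pi * l / ℓ ≤ √(lam - η j) := by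
      apply Real.le_sqrt_of_sq_le
      rw [div_pow, mul_pow]
      linarith
    have hl' : l ≤ ⌊ℓ / Real.pi * √(lam - η j)⌋₊ := by
      apply Nat.le_floor
      calc (l : ℝ) = ℓ / Real.pi * (Real.pi * l / ℓ) := by field_simp
        _ ≤ _ := by gcongr
    simp [ht, hjs, hl, hl']
  calc (Nat.card {q : ℕ × ℕ | 1 ≤ q.1 ∧ 1 ≤ q.2 ∧
        η q.1 + Real.pi ^ 2 * (q.2 : ℝ) ^ 2 / ℓ ^ 2 ≤ lam} : ℝ)
      ≤ t.card := by
        have := Nat.card_mono t.finite_toSet hsub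
        rw [Nat.card_coe_set_eq (t : Set (ℕ × ℕ)), Set.ncard_coe_finset] at this
        exact_mod_cast this
    _ ≤ ∑ j ∈ s, (⌊ℓ / Real.pi * √(lam - η j)⌋₊ : ℝ) := by
        have := Finset.card_biUnion_le (s := s)
          (t := fun j => ({j} : Finset ℕ) ×ˢ Finset.Icc 1 ⌊ℓ / Real.pi * √(lam - η j)⌋₊)
        simp only [Finset.card_product, Finset.card_singleton, Nat.card_Icc, one_mul,
          Nat.add_sub_cancel] at this
        exact_mod_cast this
    _ ≤ _ := Finset.sum_le_sum fun j _ => Nat.floor_le (by positivity)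

/-- The key inequality (KEY) in the proof of the cylinder theorem: with `m` the number of
base eigenvalues `η j ≤ λ` and `k` the number of cylinder eigenvalues `η j + π² l²/ℓ² ≤ λ`,
if `k ≥ 1` then `m ≥ 1` and
`λ ≥ π² k² / (ℓ² m²) + (n/(n+2)) 4π² m^{2/n} / (ω_n A)^{2/n}`. -/
theorem key_inequality (n : ℕ) (hn : 1 ≤ n) (A ℓ : ℝ) (hA : 0 < A) (hℓ : 0 < ℓ)
    (η : ℕ → ℝ) (hmono : Monotone η) (hBLY : BerezinLiYau n A η)
    (lam : ℝ) (hlam : 0 < lam) (m k : ℕ)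
    (hm : m = Nat.card {j : ℕ | 1 ≤ j ∧ η j ≤ lam})
    (hk : k = Nat.card {q : ℕ × ℕ | 1 ≤ q.1 ∧ 1 ≤ q.2 ∧
        η q.1 + Real.pi ^ 2 * (q.2 : ℝ) ^ 2 / ℓ ^ 2 ≤ lam})
    (hk1 : 1 ≤ k) :
    1 ≤ m ∧
      Real.pi ^ 2 * (k : ℝ) ^ 2 / (ℓ ^ 2 * (m : ℝ) ^ 2)
          + (n / (n + 2) : ℝ) * (4 * Real.pi ^ 2) * (m : ℝ) ^ ((2 : ℝ) / n)
            / (unitBallVol n * A) ^ ((2 : ℝ) / n)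
        ≤ lam := by
  have hπ := Real.pi_pos
  have hS := hmono.sublevel_eq_Icc (hBLY.exists_lt hn hA lam)
  have hcount := card_pairs_le hℓ hS
  rw [← hm] at hS
  rw [← hk, ← hm] at hcount
  have hm1 : 1 ≤ m := by
    by_contra! h0
    obtain rfl : m = 0 := by omega
    have : (1 : ℝ) ≤ k := by exact_mod_cast hk1
    simp only [Finset.Icc_eq_empty_of_lt zero_lt_one, Finset.sum_empty] at hcount
    linarith
  refine ⟨hm1, ?_⟩
  have hm0 : (0 : ℝ) < m := by exact_mod_cast hm1
  have hsq : ∑ j ∈ Finset.Icc 1 m, (ℓ / Real.pi * √(lam - η j)) ^ 2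
      = (ℓ / Real.pi) ^ 2 * (m * lam - ∑ j ∈ Finset.Icc 1 m, η j) := by
    have : ∑ j ∈ Finset.Icc 1 m, (lam - η j) = m * lam - ∑ j ∈ Finset.Icc 1 m, η j := by
      simp [Finset.sum_sub_distrib]
    rw [← this, Finset.mul_sum]
    refine Finset.sum_congr rfl fun j hj => ?_
    have hj' : j ∈ {j : ℕ | 1 ≤ j ∧ η j ≤ lam} := by
      rw [hS]
      exact hj
    rw [mul_pow, Real.sq_sqrt (sub_nonneg.mpr hj'.2)]
  have hCS : (k : ℝ) ^ 2
      ≤ m * ((ℓ / Real.pi) ^ 2 * (m * lam - ∑ j ∈ Finset.Icc 1 m, η j)) := by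
    calc (k : ℝ) ^ 2 ≤ (∑ j ∈ Finset.Icc 1 m, ℓ / Real.pi * √(lam - η j)) ^ 2 := by gcongr
      _ ≤ _ := by
        have := sq_sum_le_card_mul_sum_sq (s := Finset.Icc 1 m)
          (f := fun j => ℓ / Real.pi * √(lam - η j))
        rwa [hsq, Nat.card_Icc, Nat.add_sub_cancel] at this
  have hmean := hBLY.mul_le_sum hm1
  set B := (n / (n + 2) : ℝ) * (4 * Real.pi ^ 2) * (m : ℝ) ^ ((2 : ℝ) / n)
    / (unitBallVol n * A) ^ ((2 : ℝ) / n)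
  have hmain : (k : ℝ) ^ 2 ≤ m * ((ℓ / Real.pi) ^ 2 * (m * lam - m * B)) :=
    hCS.trans (by gcongr)
  have hfirst : Real.pi ^ 2 * (k : ℝ) ^ 2 / (ℓ ^ 2 * (m : ℝ) ^ 2) ≤ lam - B := by
    rw [div_le_iff₀ (by positivity)]
    calc Real.pi ^ 2 * (k : ℝ) ^ 2
        ≤ Real.pi ^ 2 * (m * ((ℓ / Real.pi) ^ 2 * (m * lam - m * B))) := by gcongr
      _ = _ := by field_simp
  linarith
end

section
/- For every natural number n ≥ 2, one has (n+1)/(n+3) < ((n+1)/(n+2)) · (π/2)^{1/(n+1)} < α_{n+1}. -/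
/-- The constant `α_m` from the paper's cylinder theorem. -/
noncomputable def alphaConst (m : ℕ) : ℝ :=
  ((m : ℝ) / ((m : ℝ) + 1) ^ (1 - 1 / (m : ℝ))) * (Real.pi / 4) ^ (1 / (m : ℝ)) *
    (Real.Gamma (((m : ℝ) + 1) / 2) / Real.Gamma (((m : ℝ) + 2) / 2)) ^ (2 / (m : ℝ))

theorem Real.Gamma_add_half_sq_le {x : ℝ} (hx : 0 < x) :
    Real.Gamma (x + 1 / 2) ^ 2 ≤ Real.Gamma x * Real.Gamma (x + 1) := by
  have h := Real.Gamma_mul_add_mul_le_rpow_Gamma_mul_rpow_Gamma hx (by linarith : 0 < x + 1)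
    (a := 1 / 2) (b := 1 / 2) (by norm_num) (by norm_num) (by norm_num)
  rw [show 1 / 2 * x + 1 / 2 * (x + 1) = x + 1 / 2 by ring, ← Real.sqrt_eq_rpow,
    ← Real.sqrt_eq_rpow, ← Real.sqrt_mul (Real.Gamma_pos_of_pos hx).le] at h
  exact (Real.le_sqrt' (Real.Gamma_pos_of_pos (by linarith))).1 h

/-- The strict form of Wendel's inequality for a half-integer shift. -/
theorem Real.Gamma_add_half_sq_lt {x : ℝ} (hx : 0 < x) :
    Real.Gamma (x + 1 / 2) ^ 2 < x * Real.Gamma x ^ 2 := by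
  have h := Real.Gamma_add_half_sq_le (by linarith : 0 < x + 1)
  rw [show x + 1 + 1 / 2 = (x + 1 / 2) + 1 by ring,
    Real.Gamma_add_one (s := x + 1 / 2) (by positivity),
    Real.Gamma_add_one (s := x + 1) (by positivity), Real.Gamma_add_one hx.ne'] at h
  have hb : 0 < Real.Gamma (x + 1 / 2) ^ 2 := pow_pos (Real.Gamma_pos_of_pos (by linarith)) 2
  have hc : 0 < x * (x + 1) := by positivity
  refine lt_of_mul_lt_mul_left ?_ hc.le
  nlinarith

theorem alphaConst_eq {m : ℕ} (hm : m ≠ 0) :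
    alphaConst m = (m : ℝ) / (m + 1) * (((m : ℝ) + 1) * (Real.pi / 4) *
      (Real.Gamma (((m : ℝ) + 1) / 2) / Real.Gamma (((m : ℝ) + 2) / 2)) ^ 2) ^ (1 / (m : ℝ)) := by
  have hq : 0 < Real.Gamma (((m : ℝ) + 1) / 2) / Real.Gamma (((m : ℝ) + 2) / 2) :=
    div_pos (Real.Gamma_pos_of_pos (by positivity)) (Real.Gamma_pos_of_pos (by positivity))
  have hm1 : (0 : ℝ) < m + 1 := by positivity
  have hpi := Real.pi_pos
  rw [alphaConst, Real.mul_rpow (by positivity) (by positivity),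
    Real.mul_rpow (by positivity) (by positivity), Real.rpow_sub hm1, Real.rpow_one,
    ← Real.rpow_natCast _ 2, ← Real.rpow_mul hq.le, Nat.cast_ofNat, mul_one_div]
  have := Real.rpow_pos_of_pos hm1 (1 / (m : ℝ))
  field_simp

/-- Lower-bound part of the chain of inequalities in the cylinder theorem:
`β_{n+1} = (n+1)/(n+3) < ((n+1)/(n+2)) (π/2)^{1/(n+1)} < α_{n+1}`. -/
theorem alpha_lower_bounds (n : ℕ) (hn : 2 ≤ n) :
    ((n : ℝ) + 1) / ((n : ℝ) + 3)
        < (((n : ℝ) + 1) / ((n : ℝ) + 2)) * (Real.pi / 2) ^ ((1 : ℝ) / ((n : ℝ) + 1)) ∧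
      (((n : ℝ) + 1) / ((n : ℝ) + 2)) * (Real.pi / 2) ^ ((1 : ℝ) / ((n : ℝ) + 1))
        < alphaConst (n + 1) := by
  have hpi := Real.pi_gt_three
  constructor
  · have h1 : 1 < (Real.pi / 2) ^ ((1 : ℝ) / ((n : ℝ) + 1)) :=
      Real.one_lt_rpow (by linarith) (by positivity)
    calc ((n : ℝ) + 1) / ((n : ℝ) + 3) < ((n : ℝ) + 1) / ((n : ℝ) + 2) := by gcongr; norm_num
      _ < _ := lt_mul_of_one_lt_right (by positivity) h1
  · rw [alphaConst_eq n.succ_ne_zero]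
    push_cast
    rw [show (n : ℝ) + 1 + 1 = n + 2 by ring, show (n : ℝ) + 1 + 2 = n + 3 by ring]
    refine mul_lt_mul_of_pos_left (Real.rpow_lt_rpow (by positivity) ?_ (by positivity))
      (by positivity)
    have h := Real.Gamma_add_half_sq_lt (x := ((n : ℝ) + 2) / 2) (by positivity)
    rw [show ((n : ℝ) + 2) / 2 + 1 / 2 = (n + 3) / 2 by ring] at h
    have hb : 0 < Real.Gamma (((n : ℝ) + 3) / 2) ^ 2 :=
      pow_pos (Real.Gamma_pos_of_pos (by positivity)) 2
    rw [div_pow, ← mul_div_assoc, lt_div_iff₀ hb]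
    nlinarith
end

section
/- The sequence n·(1 − α_n) converges, as n → ∞, to 1 − log(π/2); equivalently, α_n = 1 − (1 − log(π/2))/n + o(1/n). -/
/-- Log-convexity of `Γ` at the midpoint of `x` and `x + 1`. -/
theorem two_mul_log_Gamma_add_half_le {x : ℝ} (hx : 0 < x) :
    2 * Real.log (Real.Gamma (x + 1 / 2)) ≤
      Real.log (Real.Gamma x) + Real.log (Real.Gamma (x + 1)) := by
  have h := Real.convexOn_log_Gamma.2 (Set.mem_Ioi.2 hx)
    (Set.mem_Ioi.2 (by linarith : (0 : ℝ) < x + 1))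
    (show (0 : ℝ) ≤ 1 / 2 by norm_num) (show (0 : ℝ) ≤ 1 / 2 by norm_num) (by norm_num)
  simp only [smul_eq_mul, Function.comp_apply] at h
  rw [show 1 / 2 * x + 1 / 2 * (x + 1) = x + 1 / 2 by ring] at h
  linarith

theorem log_Gamma_add_one {x : ℝ} (hx : 0 < x) :
    Real.log (Real.Gamma (x + 1)) = Real.log x + Real.log (Real.Gamma x) := by
  rw [Real.Gamma_add_one hx.ne', Real.log_mul hx.ne' (Real.Gamma_pos_of_pos hx).ne']

/-- The ratio `Γ((m+1)/2) / Γ((m+2)/2)` is asymptotic to `((m+1)/2) ^ (-1/2)`. -/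
theorem tendsto_log_Gamma_half_ratio :
    Filter.Tendsto (fun m : ℕ => 2 * (Real.log (Real.Gamma (((m : ℝ) + 1) / 2)) -
      Real.log (Real.Gamma (((m : ℝ) + 2) / 2))) + Real.log (((m : ℝ) + 1) / 2))
      Filter.atTop (nhds 0) := by
  have hu : Filter.Tendsto (fun m : ℕ => Real.log (1 + 1 / (m : ℝ))) Filter.atTop (nhds 0) := by
    have h : Filter.Tendsto (fun m : ℕ => 1 + 1 / (m : ℝ)) Filter.atTop (nhds 1) := by
      simpa using tendsto_one_div_atTop_nhds_zero_nat.const_add (1 : ℝ)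
    simpa using h.log one_ne_zero
  refine tendsto_of_tendsto_of_tendsto_of_le_of_le' tendsto_const_nhds hu ?_ ?_
  · filter_upwards with m
    have hm : (0 : ℝ) < ((m : ℝ) + 1) / 2 := by positivity
    have h := two_mul_log_Gamma_add_half_le hm
    rw [log_Gamma_add_one hm, show ((m : ℝ) + 1) / 2 + 1 / 2 = ((m : ℝ) + 2) / 2 by ring] at h
    linarith
  · filter_upwards [Filter.eventually_gt_atTop 0] with m hm
    have hm' : (0 : ℝ) < m := Nat.cast_pos.2 hm
    have hm2 : (0 : ℝ) < (m : ℝ) / 2 := by positivity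
    have h := two_mul_log_Gamma_add_half_le hm2
    have h1 := log_Gamma_add_one hm2
    rw [show (m : ℝ) / 2 + 1 = ((m : ℝ) + 2) / 2 by ring] at h h1
    rw [show (m : ℝ) / 2 + 1 / 2 = ((m : ℝ) + 1) / 2 by ring] at h
    have h2 : Real.log (1 + 1 / (m : ℝ)) =
        Real.log (((m : ℝ) + 1) / 2) - Real.log ((m : ℝ) / 2) := by
      rw [← Real.log_div (by positivity) (by positivity)]
      congr 1
      field_simp
    linarith

theorem alphaConst_pos {m : ℕ} (hm : 0 < m) : 0 < alphaConst m := by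
  have hm' : (0 : ℝ) < m := Nat.cast_pos.2 hm
  have h1 := Real.Gamma_pos_of_pos (show (0 : ℝ) < ((m : ℝ) + 1) / 2 by positivity)
  have h2 := Real.Gamma_pos_of_pos (show (0 : ℝ) < ((m : ℝ) + 2) / 2 by positivity)
  unfold alphaConst
  positivity

theorem mul_log_alphaConst {m : ℕ} (hm : 0 < m) :
    (m : ℝ) * Real.log (alphaConst m) =
      -((m : ℝ) * Real.log (1 + 1 / (m : ℝ))) + Real.log (Real.pi / 2) +
        (2 * (Real.log (Real.Gamma (((m : ℝ) + 1) / 2)) -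
          Real.log (Real.Gamma (((m : ℝ) + 2) / 2))) + Real.log (((m : ℝ) + 1) / 2)) := by
  have hm' : (0 : ℝ) < m := Nat.cast_pos.2 hm
  have h1 := Real.Gamma_pos_of_pos (show (0 : ℝ) < ((m : ℝ) + 1) / 2 by positivity)
  have h2 := Real.Gamma_pos_of_pos (show (0 : ℝ) < ((m : ℝ) + 2) / 2 by positivity)
  have hpi := Real.pi_pos
  have hsucc : (0 : ℝ) < (m : ℝ) + 1 := by positivity
  have hlog : Real.log (1 + 1 / (m : ℝ)) = Real.log ((m : ℝ) + 1) - Real.log m := by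
    rw [← Real.log_div hsucc.ne' hm'.ne']
    congr 1
    field_simp
  have hfour : Real.log (4 : ℝ) = 2 * Real.log 2 := by
    rw [show (4 : ℝ) = 2 ^ 2 by norm_num, Real.log_pow]
    norm_num
  unfold alphaConst
  rw [Real.log_mul (by positivity) (by positivity), Real.log_mul (by positivity) (by positivity),
    Real.log_div hm'.ne' (by positivity), Real.log_rpow hsucc, Real.log_rpow (by positivity),
    Real.log_rpow (by positivity), Real.log_div h1.ne' h2.ne', hlog,
    Real.log_div hpi.ne' (by norm_num), Real.log_div hpi.ne' (by norm_num),
    Real.log_div hsucc.ne' (by norm_num), hfour]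
  field_simp
  ring

/-- If `n * log (a n) → l` with `a n` eventually positive, then `n * (1 - a n) → -l`. -/
theorem tendsto_mul_one_sub_of_tendsto_mul_log {a : ℕ → ℝ} {l : ℝ}
    (ha : ∀ᶠ n in Filter.atTop, 0 < a n)
    (h : Filter.Tendsto (fun n : ℕ => (n : ℝ) * Real.log (a n)) Filter.atTop (nhds l)) :
    Filter.Tendsto (fun n : ℕ => (n : ℝ) * (1 - a n)) Filter.atTop (nhds (-l)) := by
  have hinv := tendsto_one_div_atTop_nhds_zero_nat (𝕜 := ℝ)
  have hlog : Filter.Tendsto (fun n : ℕ => Real.log (a n)) Filter.atTop (nhds 0) := by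
    have := h.mul hinv
    rw [mul_zero] at this
    refine this.congr' ?_
    filter_upwards [Filter.eventually_gt_atTop 0] with n hn
    have hn' : (n : ℝ) ≠ 0 := Nat.cast_ne_zero.2 hn.ne'
    field_simp
  have hbound : Filter.Tendsto (fun n : ℕ => (n : ℝ) * Real.log (a n) * Real.log (a n))
      Filter.atTop (nhds 0) := by
    simpa using h.mul hlog
  have herr : Filter.Tendsto (fun n : ℕ => (n : ℝ) * (a n - 1 - Real.log (a n)))
      Filter.atTop (nhds 0) := by
    refine squeeze_zero_norm' ?_ hbound
    filter_upwards [ha, hlog.abs.eventually_le_const (show |(0 : ℝ)| < 1 by simp)] with n hn hn1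
    have := Real.abs_exp_sub_one_sub_id_le hn1
    rw [Real.exp_log hn] at this
    rw [Real.norm_eq_abs, abs_mul, Nat.abs_cast, mul_assoc, ← sq]
    gcongr
  have := (h.add herr).neg
  rw [add_zero] at this
  exact this.congr fun n => by ring

/-- Asymptotic behaviour of the paper's cylinder constants:
`n (1 - α_n) → 1 - log(π/2)` as `n → ∞`. -/
theorem alpha_asymptotics :
    Filter.Tendsto (fun n : ℕ => (n : ℝ) * (1 - alphaConst n)) Filter.atTop
      (nhds (1 - Real.log (Real.pi / 2))) := by
  have hone : Filter.Tendsto (fun n : ℕ => (n : ℝ) * Real.log (1 + 1 / (n : ℝ)))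
      Filter.atTop (nhds 1) :=
    (Real.tendsto_mul_log_one_add_div_atTop 1).comp tendsto_natCast_atTop_atTop
  have hpos := Filter.eventually_gt_atTop (0 : ℕ)
  have h := (hone.neg.add_const (Real.log (Real.pi / 2))).add tendsto_log_Gamma_half_ratio
  have hlim := tendsto_mul_one_sub_of_tendsto_mul_log (hpos.mono fun _ => alphaConst_pos)
    (h.congr' (hpos.mono fun _ hn => (mul_log_alphaConst hn).symm))
  convert hlim using 2
  ring
end
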